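/- arXiv:1307.4948 — 2 statements merged into one kernel-verified Lean document; each statement's English description precedes it below -/
import Mathlib

section
/- Let f and φ be Lebesgue-measurable functions on ℝⁿ such that |f(x)| ≤ β for all x and f vanishes outside a measurable set E of Lebesgue measure r. Then for every t > 0, (f∗φ)**(t) ≤ β · r · φ**(r). -/
open MeasureTheory Set
open scoped ENNReal

/-- Distribution function: `μ {x : |f x| > s}`. -/
noncomputable def distrib {X : Type*} [MeasurableSpace X] (μ : Measure X)
    (f : X → ℝ) (s : ℝ) : ℝ≥0∞ :=
  μ {x | s < |f x|}

/-- Decreasing rearrangement: `f*(t) = inf {s > 0 : λ_f(s) ≤ t}`. -/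
noncomputable def rearr {X : Type*} [MeasurableSpace X] (μ : Measure X)
    (f : X → ℝ) (t : ℝ) : ℝ≥0∞ :=
  ⨅ (s : ℝ) (_ : 0 < s ∧ distrib μ f s ≤ ENNReal.ofReal t), ENNReal.ofReal s

/-- Maximal function `f**(t) = (1/t) ∫₀ᵗ f*(u) du`. -/
noncomputable def maxFn {X : Type*} [MeasurableSpace X] (μ : Measure X)
    (f : X → ℝ) (t : ℝ) : ℝ≥0∞ :=
  (ENNReal.ofReal t)⁻¹ * ∫⁻ u in Set.Ioc (0:ℝ) t, rearr μ f u

/-- Lorentz norm `‖f‖_{p,q}`; for `q = ∞` it is `sup_{t>0} t^{1/p} f**(t)`. -/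
noncomputable def lorentzNorm {X : Type*} [MeasurableSpace X] (μ : Measure X)
    (f : X → ℝ) (p : ℝ) (q : ℝ≥0∞) : ℝ≥0∞ :=
  if q = ⊤ then ⨆ (t : ℝ) (_ : 0 < t), ENNReal.ofReal t ^ (1/p) * maxFn μ f t
  else (∫⁻ t in Set.Ioi (0:ℝ),
      (ENNReal.ofReal t ^ (1/p) * maxFn μ f t) ^ q.toReal * (ENNReal.ofReal t)⁻¹) ^ (1 / q.toReal)

/-- Convolution on ℝⁿ: `(f ∗ g)(x) = ∫ f(x-y) g(y) dy`. -/
noncomputable def conv {n : ℕ} (f g : EuclideanSpace ℝ (Fin n) → ℝ)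
    (x : EuclideanSpace ℝ (Fin n)) : ℝ :=
  ∫ y, f (x - y) * g y

/-- `‖f‖_p = (∫ |f|^p dμ)^{1/p}`. -/
noncomputable def lpNorm {X : Type*} [MeasurableSpace X] (μ : Measure X)
    (f : X → ℝ) (p : ℝ) : ℝ≥0∞ :=
  (∫⁻ x, ENNReal.ofReal |f x| ^ p ∂μ) ^ (1/p)

/-- Riesz potential `I_α f(x) = ∫ |x-y|^{α-n} f(y) dy` on ℝⁿ. -/
noncomputable def riesz (n : ℕ) (α : ℝ) (f : EuclideanSpace ℝ (Fin n) → ℝ)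
    (x : EuclideanSpace ℝ (Fin n)) : ℝ :=
  ∫ y, ‖x - y‖ ^ (α - (n:ℝ)) * f y

theorem distrib_antitone {X : Type*} [MeasurableSpace X] (μ : Measure X) (f : X → ℝ) :
    Antitone (distrib μ f) := fun _ _ hab =>
  measure_mono fun _ hx => lt_of_le_of_lt hab hx

theorem volume_setOf_lt_distrib_le_rearr {X : Type*} [MeasurableSpace X] (μ : Measure X)
    (f : X → ℝ) (u : ℝ) :
    volume.restrict (Ioi (0 : ℝ)) {s | ENNReal.ofReal u < distrib μ f s} ≤ rearr μ f u := by
  refine le_iInf₂ fun s hs => ?_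
  rw [Measure.restrict_apply' measurableSet_Ioi]
  calc volume ({s | ENNReal.ofReal u < distrib μ f s} ∩ Ioi 0) ≤ volume (Ioc 0 s) := by
        refine measure_mono fun a ha => ⟨ha.2, ?_⟩
        by_contra! h
        exact absurd ha.1 (not_lt.2 ((distrib_antitone μ f h.le).trans hs.2))
    _ = ENNReal.ofReal s := by simp

theorem min_le_volume_setOf_ofReal_lt (r : ℝ) (L : ℝ≥0∞) :
    min (ENNReal.ofReal r) L ≤ volume.restrict (Ioc 0 r) {u : ℝ | ENNReal.ofReal u < L} := by
  rw [Measure.restrict_apply' measurableSet_Ioc]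
  have hfin : min (ENNReal.ofReal r) L ≠ ⊤ := ne_top_of_le_ne_top ENNReal.ofReal_ne_top
    (min_le_left _ _)
  calc min (ENNReal.ofReal r) L
      = volume (Ioo 0 (min (ENNReal.ofReal r) L).toReal) := by
        rw [Real.volume_Ioo, sub_zero, ENNReal.ofReal_toReal hfin]
    _ ≤ _ := by
        refine measure_mono fun u hu => ?_
        have h := (ENNReal.ofReal_lt_iff_lt_toReal hu.1.le hfin).2 hu.2
        rw [lt_min_iff] at h
        exact ⟨h.2, hu.1, (ENNReal.ofReal_lt_ofReal_iff'.1 h.1).1.le⟩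

theorem setLIntegral_abs_le_lintegral_rearr {X : Type*} [MeasurableSpace X] (μ : Measure X)
    {f : X → ℝ} (hf : Measurable f) {A : Set X} {r : ℝ} (hA : μ A ≤ ENNReal.ofReal r) :
    ∫⁻ x in A, ENNReal.ofReal |f x| ∂μ ≤ ∫⁻ u in Ioc (0 : ℝ) r, rearr μ f u := by
  have habs : Measurable fun x => |f x| := hf.abs
  have hS : MeasurableSet {p : ℝ × ℝ | ENNReal.ofReal p.2 < distrib μ f p.1} :=
    measurableSet_lt (ENNReal.measurable_ofReal.comp measurable_snd)
      ((distrib_antitone μ f).measurable.comp measurable_fst)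
  rw [lintegral_eq_lintegral_meas_lt _ (Filter.Eventually.of_forall fun x => abs_nonneg (f x))
    habs.aemeasurable]
  calc ∫⁻ s in Ioi (0 : ℝ), μ.restrict A {x | s < |f x|}
      ≤ ∫⁻ s in Ioi (0 : ℝ),
          volume.restrict (Ioc 0 r) {u : ℝ | ENNReal.ofReal u < distrib μ f s} := by
        refine lintegral_mono fun s => le_trans (le_min ?_ ?_) (min_le_volume_setOf_ofReal_lt r _)
        · exact (measure_mono (subset_univ _)).trans (by simpa using hA)
        · exact Measure.restrict_apply_le _ _
    _ = ((volume.restrict (Ioi 0)).prod (volume.restrict (Ioc 0 r)))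
          {p : ℝ × ℝ | ENNReal.ofReal p.2 < distrib μ f p.1} := (Measure.prod_apply hS).symm
    _ = ∫⁻ u in Ioc (0 : ℝ) r,
          volume.restrict (Ioi (0 : ℝ)) {s | ENNReal.ofReal u < distrib μ f s} :=
        Measure.prod_apply_symm hS
    _ ≤ _ := lintegral_mono fun u => volume_setOf_lt_distrib_le_rearr μ f u

theorem rearr_le_of_abs_le {X : Type*} [MeasurableSpace X] (μ : Measure X) {f : X → ℝ}
    {C : ℝ≥0∞} (hf : ∀ x, ENNReal.ofReal |f x| ≤ C) (u : ℝ) : rearr μ f u ≤ C := by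
  refine le_of_forall_gt_imp_ge_of_dense fun a ha => ?_
  rcases eq_or_ne a ⊤ with rfl | hatop
  · exact le_top
  have ha0 : 0 < a.toReal := ENNReal.toReal_pos (ne_bot_of_gt ha) hatop
  have hempty : {x | a.toReal < |f x|} = ∅ := by
    refine eq_empty_of_forall_notMem fun x hx => ?_
    have h := (ENNReal.lt_ofReal_iff_toReal_lt hatop).2 hx
    exact absurd (h.trans_le (hf x)) ha.not_gt
  refine (iInf₂_le a.toReal ⟨ha0, by simp [distrib, hempty]⟩).trans ?_
  rw [ENNReal.ofReal_toReal hatop]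

theorem maxFn_le_of_abs_le {X : Type*} [MeasurableSpace X] (μ : Measure X) {f : X → ℝ}
    {C : ℝ≥0∞} (hf : ∀ x, ENNReal.ofReal |f x| ≤ C) {t : ℝ} (ht : 0 < t) :
    maxFn μ f t ≤ C := by
  calc maxFn μ f t ≤ (ENNReal.ofReal t)⁻¹ * ∫⁻ _ in Ioc (0 : ℝ) t, C :=
        mul_le_mul_right (lintegral_mono fun u => rearr_le_of_abs_le μ hf u) _
    _ = C := by
        rw [setLIntegral_const, Real.volume_Ioc, sub_zero, mul_comm C, ← mul_assoc,
          ENNReal.inv_mul_cancel (by simpa using ht) ENNReal.ofReal_ne_top, one_mul]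

theorem abs_conv_le_of_bounded_support {n : ℕ} {f φ : EuclideanSpace ℝ (Fin n) → ℝ}
    (hφ : Measurable φ) {β r : ℝ} (hβ : ∀ x, |f x| ≤ β)
    {E : Set (EuclideanSpace ℝ (Fin n))} (hE : MeasurableSet E)
    (hEr : volume E ≤ ENNReal.ofReal r) (hfE : ∀ x ∉ E, f x = 0)
    (x : EuclideanSpace ℝ (Fin n)) :
    ENNReal.ofReal |conv f φ x| ≤
      ENNReal.ofReal β * ∫⁻ u in Ioc (0 : ℝ) r, rearr volume φ u := by
  have hpre := Measure.measurePreserving_sub_left (volume : Measure (EuclideanSpace ℝ (Fin n))) x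
  have hA : MeasurableSet ((fun y => x - y) ⁻¹' E) := hpre.measurable hE
  calc ENNReal.ofReal |conv f φ x| = ‖conv f φ x‖ₑ := (Real.enorm_eq_ofReal_abs _).symm
    _ ≤ ∫⁻ y, ‖f (x - y) * φ y‖ₑ := enorm_integral_le_lintegral_enorm _
    _ ≤ ∫⁻ y, ((fun y => x - y) ⁻¹' E).indicator
          (fun y => ENNReal.ofReal β * ENNReal.ofReal |φ y|) y := by
        refine lintegral_mono fun y => ?_
        by_cases hy : x - y ∈ E
        · rw [indicator_of_mem (by exact hy), enorm_mul, Real.enorm_eq_ofReal_abs,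
            Real.enorm_eq_ofReal_abs]
          gcongr
          exact hβ _
        · simp [hfE _ hy]
    _ = ENNReal.ofReal β * ∫⁻ y in (fun y => x - y) ⁻¹' E, ENNReal.ofReal |φ y| := by
        rw [lintegral_indicator hA, lintegral_const_mul' _ _ ENNReal.ofReal_ne_top]
    _ ≤ _ := by
        gcongr
        refine setLIntegral_abs_le_lintegral_rearr volume hφ ?_
        rwa [hpre.measure_preimage hE.nullMeasurableSet]

/-- If `|f| ≤ β` everywhere and `f` vanishes outside a measurable set `E` of
Lebesgue measure `r`, then for every `t > 0`, `(f∗φ)**(t) ≤ β r φ**(r)`. -/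
theorem conv_maxFn_le_of_bounded_support_at_r (n : ℕ)
    (f φ : EuclideanSpace ℝ (Fin n) → ℝ) (hf : Measurable f) (hφ : Measurable φ)
    (β r : ℝ) (hβ : ∀ x, |f x| ≤ β)
    (E : Set (EuclideanSpace ℝ (Fin n))) (hE : MeasurableSet E)
    (hr : 0 ≤ r) (hEr : volume E = ENNReal.ofReal r)
    (hfE : ∀ x ∉ E, f x = 0)
    (t : ℝ) (ht : 0 < t) :
    maxFn volume (conv f φ) t ≤
      ENNReal.ofReal β * ENNReal.ofReal r * maxFn volume φ r := by
  refine (maxFn_le_of_abs_le volume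
    (abs_conv_le_of_bounded_support hφ hβ hE hEr.le hfE) ht).trans ?_
  rcases hr.eq_or_lt with rfl | hr
  · simp
  · rw [maxFn, mul_assoc, ← mul_assoc (ENNReal.ofReal r),
      ENNReal.mul_inv_cancel (by simpa using hr) ENNReal.ofReal_ne_top, one_mul]
end

section
/- O'Neil's inequality: if f and φ are Lebesgue-measurable functions on ℝⁿ, then for every t > 0, (f∗φ)**(t) ≤ t · f**(t) · φ**(t) + ∫_t^∞ f*(s) φ*(s) ds. -/
open MeasureTheory Set
open scoped ENNReal

section Rearrangement

theorem volume_Ioi_inter_ofReal_lt {t : ℝ} (ht : 0 ≤ t) (c : ℝ≥0∞) :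
    volume ({u : ℝ | ENNReal.ofReal u < c} ∩ Ioi t) = c - ENNReal.ofReal t := by
  induction c using ENNReal.recTopCoe with
  | top => simp
  | coe c =>
    have : {u : ℝ | ENNReal.ofReal u < c} ∩ Ioi t = Ioo t c := by
      ext u
      simp only [mem_inter_iff, mem_ofPred_eq, mem_Ioi, mem_Ioo]
      constructor
      · rintro ⟨h, hu⟩
        rw [← ENNReal.ofReal_coe_nnreal, ENNReal.ofReal_lt_ofReal_iff_of_nonneg (ht.trans hu.le)] at h
        exact ⟨hu, h⟩
      · rintro ⟨hu, h⟩
        rw [← ENNReal.ofReal_coe_nnreal, ENNReal.ofReal_lt_ofReal_iff_of_nonneg (ht.trans hu.le)]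
        exact ⟨h, hu⟩
    rw [this, Real.volume_Ioo, ENNReal.ofReal_sub _ ht, ENNReal.ofReal_coe_nnreal]

theorem volume_Ioc_inter_ofReal_lt {t : ℝ} (ht : 0 < t) (c : ℝ≥0∞) :
    volume ({u : ℝ | ENNReal.ofReal u < c} ∩ Ioc 0 t) = min (ENNReal.ofReal t) c := by
  rcases lt_or_ge (ENNReal.ofReal t) c with h | h
  · have : {u : ℝ | ENNReal.ofReal u < c} ∩ Ioc 0 t = Ioc 0 t :=
      inter_eq_right.2 fun u hu => (ENNReal.ofReal_le_ofReal hu.2).trans_lt h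
    rw [this, Real.volume_Ioc, sub_zero, min_eq_left h.le]
  · have : {u : ℝ | ENNReal.ofReal u < c} ∩ Ioc 0 t = {u : ℝ | ENNReal.ofReal u < c} ∩ Ioi 0 := by
      ext u
      simp only [mem_inter_iff, mem_ofPred_eq, mem_Ioc, mem_Ioi]
      refine ⟨fun hu => ⟨hu.1, hu.2.1⟩, fun hu => ⟨hu.1, hu.2, ?_⟩⟩
      exact (ENNReal.ofReal_le_ofReal_iff ht.le).1 (hu.1.le.trans h)
    rw [this, volume_Ioi_inter_ofReal_lt le_rfl, min_eq_right h, ENNReal.ofReal_zero, tsub_zero]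

variable {X : Type*} [MeasurableSpace X] {μ : Measure X}

theorem antitone_distrib (f : X → ℝ) : Antitone (distrib μ f) := fun _ _ hst =>
  measure_mono fun _ hx => lt_of_le_of_lt hst hx

theorem measurable_distrib (f : X → ℝ) : Measurable (distrib μ f) :=
  (antitone_distrib f).measurable

theorem rearr_eq_volume (f : X → ℝ) (u : ℝ) :
    rearr μ f u = volume ({s : ℝ | ENNReal.ofReal u < distrib μ f s} ∩ Ioi 0) := by
  apply le_antisymm
  · refine ENNReal.le_of_forall_nnreal_lt fun c hc => ?_
    have : Ioc 0 (c : ℝ) ⊆ {s : ℝ | ENNReal.ofReal u < distrib μ f s} ∩ Ioi 0 := by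
      rintro s ⟨hs, hsc⟩
      refine ⟨?_, hs⟩
      by_contra h
      refine hc.not_ge ((iInf₂_le s ⟨hs, not_lt.1 h⟩).trans ?_)
      rw [← ENNReal.ofReal_coe_nnreal]
      exact ENNReal.ofReal_le_ofReal hsc
    simpa using measure_mono (μ := volume) this
  · refine le_iInf₂ fun s hs => ?_
    have : {r : ℝ | ENNReal.ofReal u < distrib μ f r} ∩ Ioi 0 ⊆ Ioc 0 s := by
      rintro r ⟨hr, hr0⟩
      refine ⟨hr0, ?_⟩
      by_contra h
      exact (hr.trans_le (antitone_distrib f (not_le.1 h).le)).not_ge hs.2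
    simpa using measure_mono (μ := volume) this

theorem measurableSet_ofReal_lt_distrib (f : X → ℝ) :
    MeasurableSet {p : ℝ × ℝ | ENNReal.ofReal p.1 < distrib μ f p.2} :=
  measurableSet_lt (ENNReal.measurable_ofReal.comp measurable_fst)
    ((measurable_distrib f).comp measurable_snd)

theorem rearr_eq_lintegral (f : X → ℝ) (u : ℝ) :
    rearr μ f u = ∫⁻ s in Ioi (0 : ℝ),
      {p : ℝ × ℝ | ENNReal.ofReal p.1 < distrib μ f p.2}.indicator 1 (u, s) := by
  have hm : MeasurableSet {s : ℝ | ENNReal.ofReal u < distrib μ f s} :=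
    measurableSet_lt measurable_const (measurable_distrib f)
  rw [rearr_eq_volume, ← Measure.restrict_apply hm, ← lintegral_indicator_one hm]
  rfl

theorem lintegral_rearr (f : X → ℝ) {t : ℝ} (ht : 0 < t) :
    ∫⁻ u in Ioc 0 t, rearr μ f u
      = ∫⁻ s in Ioi (0 : ℝ), min (ENNReal.ofReal t) (distrib μ f s) := by
  simp_rw [rearr_eq_lintegral]
  rw [lintegral_lintegral_swap]
  · refine lintegral_congr fun s => ?_
    have hm : MeasurableSet {u : ℝ | ENNReal.ofReal u < distrib μ f s} :=
      measurableSet_lt ENNReal.measurable_ofReal measurable_const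
    rw [← volume_Ioc_inter_ofReal_lt ht, ← Measure.restrict_apply hm, ← lintegral_indicator_one hm]
    rfl
  · exact (measurable_one.indicator (measurableSet_ofReal_lt_distrib f)).aemeasurable

theorem lintegral_Ioi_rearr_mul_rearr {Y : Type*} [MeasurableSpace Y] {ν : Measure Y}
    (f : X → ℝ) (g : Y → ℝ) {t : ℝ} (ht : 0 < t) :
    ∫⁻ u in Ioi t, rearr μ f u * rearr ν g u
      = ∫⁻ p, (min (distrib μ f p.1) (distrib ν g p.2) - ENNReal.ofReal t)
          ∂((volume.restrict (Ioi (0 : ℝ))).prod (volume.restrict (Ioi (0 : ℝ)))) := by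
  have hf := (measurable_one (α := ℝ≥0∞)).indicator (measurableSet_ofReal_lt_distrib (μ := μ) f)
  have hg := (measurable_one (α := ℝ≥0∞)).indicator (measurableSet_ofReal_lt_distrib (μ := ν) g)
  simp_rw [rearr_eq_lintegral]
  have (u : ℝ) := lintegral_prod_mul (μ := volume.restrict (Ioi (0 : ℝ)))
    (ν := volume.restrict (Ioi (0 : ℝ)))
    (hf.comp (measurable_const.prodMk measurable_id : Measurable fun s : ℝ => (u, s))).aemeasurable
    (hg.comp (measurable_const.prodMk measurable_id : Measurable fun s : ℝ => (u, s))).aemeasurable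
  simp only [Function.comp_apply] at this
  simp_rw [← this]
  rw [lintegral_lintegral_swap]
  · refine lintegral_congr fun p => ?_
    have hm : MeasurableSet
        {u : ℝ | ENNReal.ofReal u < min (distrib μ f p.1) (distrib ν g p.2)} :=
      measurableSet_lt ENNReal.measurable_ofReal measurable_const
    rw [← volume_Ioi_inter_ofReal_lt ht.le, ← Measure.restrict_apply hm,
      ← lintegral_indicator_one hm]
    refine lintegral_congr fun u => ?_
    by_cases h1 : ENNReal.ofReal u < distrib μ f p.1 <;>
      by_cases h2 : ENNReal.ofReal u < distrib ν g p.2 <;> simp [indicator, h1, h2]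
  · refine Measurable.aemeasurable ?_
    exact (hf.comp (measurable_fst.prodMk (measurable_fst.comp measurable_snd))).mul
      (hg.comp (measurable_fst.prodMk (measurable_snd.comp measurable_snd)))

theorem lintegral_Ioi_measure_ofReal_lt [SFinite μ] {H : X → ℝ≥0∞} (hH : Measurable H) :
    ∫⁻ s in Ioi (0 : ℝ), μ {x | ENNReal.ofReal s < H x} = ∫⁻ x, H x ∂μ := by
  have hm : MeasurableSet {p : ℝ × X | ENNReal.ofReal p.1 < H p.2} :=
    measurableSet_lt (ENNReal.measurable_ofReal.comp measurable_fst) (hH.comp measurable_snd)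
  calc _ = ∫⁻ s in Ioi (0 : ℝ), ∫⁻ x,
        {p : ℝ × X | ENNReal.ofReal p.1 < H p.2}.indicator 1 (s, x) ∂μ := by
        refine lintegral_congr fun s => ?_
        rw [← lintegral_indicator_one (measurableSet_lt measurable_const hH)]
        rfl
    _ = ∫⁻ x, (∫⁻ s in Ioi (0 : ℝ),
        {p : ℝ × X | ENNReal.ofReal p.1 < H p.2}.indicator 1 (s, x)) ∂μ :=
        lintegral_lintegral_swap (measurable_one.indicator hm).aemeasurable
    _ = _ := by
        refine lintegral_congr fun x => ?_
        have hx : MeasurableSet {s : ℝ | ENNReal.ofReal s < H x} :=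
          measurableSet_lt ENNReal.measurable_ofReal measurable_const
        have := volume_Ioi_inter_ofReal_lt le_rfl (H x)
        rw [ENNReal.ofReal_zero, tsub_zero, ← Measure.restrict_apply hx,
          ← lintegral_indicator_one hx] at this
        exact this

theorem lintegral_rearr_le_of_le_add [SFinite μ] {h : X → ℝ} {H : X → ℝ≥0∞} {B : ℝ≥0∞}
    (hH : Measurable H) (hle : ∀ x, ‖h x‖ₑ ≤ H x + B) {t : ℝ} (ht : 0 < t) :
    ∫⁻ u in Ioc 0 t, rearr μ h u ≤ ∫⁻ x, H x ∂μ + ENNReal.ofReal t * B := by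
  induction B using ENNReal.recTopCoe with
  | top => simp [ENNReal.mul_top, ht]
  | coe B =>
    rw [lintegral_rearr h ht, ← Ioc_union_Ioi_eq_Ioi B.coe_nonneg,
      lintegral_union measurableSet_Ioi (Ioc_disjoint_Ioi le_rfl), add_comm]
    gcongr
    · have hshift := (measurePreserving_add_right (volume : Measure ℝ)
        (B : ℝ)).setLIntegral_comp_preimage_emb (measurableEmbedding_addRight (B : ℝ))
        (fun s => min (ENNReal.ofReal t) (distrib μ h s)) (Ioi (B : ℝ))
      change ∫⁻ s in Ioi (B : ℝ), _ ≤ _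
      rw [← hshift, ← lintegral_Ioi_measure_ofReal_lt hH]
      have : (fun x : ℝ => x + (B : ℝ)) ⁻¹' Ioi (B : ℝ) = Ioi 0 := by
        ext; simp
      rw [this]
      refine setLIntegral_mono' measurableSet_Ioi fun s hs => (min_le_right _ _).trans ?_
      refine measure_mono fun x hx => ?_
      have h1 : ENNReal.ofReal s + B < H x + B := by
        refine lt_of_lt_of_le ?_ (hle x)
        rw [← ofReal_norm, Real.norm_eq_abs, ← ENNReal.ofReal_coe_nnreal,
          ← ENNReal.ofReal_add (mem_Ioi.1 hs).le B.coe_nonneg]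
        exact (ENNReal.ofReal_lt_ofReal_iff_of_nonneg (add_nonneg (mem_Ioi.1 hs).le B.coe_nonneg)).2 hx
      exact lt_of_add_lt_add_right h1
    · calc _ ≤ ∫⁻ s in Ioc (0 : ℝ) B, ENNReal.ofReal t := lintegral_mono fun s => min_le_left _ _
        _ = _ := by simp

theorem enorm_eq_lintegral_indicator {Y : Type*} (f : Y → ℝ) (x : Y) :
    ‖f x‖ₑ = ∫⁻ s in Ioi (0 : ℝ), {p : Y × ℝ | p.2 < |f p.1|}.indicator 1 (x, s) := by
  have hm : MeasurableSet {s : ℝ | s < |f x|} := measurableSet_Iio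
  have : {s : ℝ | s < |f x|} ∩ Ioi 0 = Ioo 0 |f x| := by ext; simp [and_comm]
  rw [← ofReal_norm, Real.norm_eq_abs, ← sub_zero |f x|, ← Real.volume_Ioo, ← this,
    ← Measure.restrict_apply hm, ← lintegral_indicator_one hm]
  rfl

theorem lintegral_indicator_eq_distrib {f : X → ℝ} (hf : Measurable f) (s : ℝ) :
    ∫⁻ x, {p : X × ℝ | p.2 < |f p.1|}.indicator 1 (x, s) ∂μ = distrib μ f s := by
  have hm : MeasurableSet {x : X | s < |f x|} := measurableSet_lt measurable_const hf.abs
  rw [distrib, ← lintegral_indicator_one hm]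
  rfl

end Rearrangement

theorem oneil_weight_le (a b t : ℝ≥0∞) :
    (if a < t ∧ b < t then a * b else t * min a b)
      ≤ min t a * min t b + t * (min a b - t) := by
  split_ifs with h
  · rw [min_eq_right h.1.le, min_eq_right h.2.le]
    exact le_self_add
  · rcases le_total t (min a b) with hm | hm
    · rw [min_eq_left (hm.trans (min_le_left _ _)), min_eq_left (hm.trans (min_le_right _ _)),
        ← mul_add, add_tsub_cancel_of_le hm]
    · refine le_add_right ?_
      rcases le_total a b with hab | hab
      · rw [min_eq_left hab] at hm ⊢
        rw [min_eq_right hm]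
        by_cases hb : b < t
        · have : a = t := le_antisymm hm (not_lt.1 fun ha => h ⟨ha, hb⟩)
          exact absurd (this ▸ hab) (not_le.2 hb)
        · rw [min_eq_left (not_lt.1 hb), mul_comm]
      · rw [min_eq_right hab] at hm ⊢
        rw [min_eq_right hm]
        by_cases ha : a < t
        · have : b = t := le_antisymm hm (not_lt.1 fun hb => h ⟨ha, hb⟩)
          exact absurd (this ▸ hab) (not_le.2 ha)
        · rw [min_eq_left (not_lt.1 ha)]

theorem lintegral_rearr_conv_le {n : ℕ} {f φ : EuclideanSpace ℝ (Fin n) → ℝ}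
    (hf : Measurable f) (hφ : Measurable φ) {t : ℝ} (ht : 0 < t) :
    ∫⁻ u in Ioc 0 t, rearr volume (conv f φ) u
      ≤ (∫⁻ u in Ioc 0 t, rearr volume f u) * (∫⁻ u in Ioc 0 t, rearr volume φ u)
        + ENNReal.ofReal t * ∫⁻ u in Ioi t, rearr volume f u * rearr volume φ u := by
  set ν : Measure ℝ := volume.restrict (Ioi 0)
  set T := ENNReal.ofReal t
  set a := distrib volume f
  set b := distrib volume φ
  have ha : Measurable a := measurable_distrib f
  have hb : Measurable b := measurable_distrib φ
  set F : EuclideanSpace ℝ (Fin n) × ℝ → ℝ≥0∞ := {p | p.2 < |f p.1|}.indicator 1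
  set G : EuclideanSpace ℝ (Fin n) × ℝ → ℝ≥0∞ := {p | p.2 < |φ p.1|}.indicator 1
  have hFm : Measurable F :=
    measurable_one.indicator (measurableSet_lt measurable_snd (hf.comp measurable_fst).abs)
  have hGm : Measurable G :=
    measurable_one.indicator (measurableSet_lt measurable_snd (hφ.comp measurable_fst).abs)
  have hF1 (p) : F p ≤ 1 := indicator_le (fun _ _ => le_rfl) p
  have hG1 (p) : G p ≤ 1 := indicator_le (fun _ _ => le_rfl) p
  let K (p : ℝ × ℝ) (x : EuclideanSpace ℝ (Fin n)) : ℝ≥0∞ := ∫⁻ y, F (x - y, p.1) * G (y, p.2)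
  have hKm : Measurable (Function.uncurry K) := by
    refine Measurable.lintegral_prod_right (f := fun q : (ℝ × ℝ) × EuclideanSpace ℝ (Fin n) =>
      fun y => F (q.2 - y, q.1.1) * G (y, q.1.2)) ?_
    fun_prop
  have hK_le (p x) : K p x ≤ min (a p.1) (b p.2) := by
    refine le_min ?_ ?_
    · calc K p x ≤ ∫⁻ y, F (x - y, p.1) :=
            lintegral_mono fun y => mul_le_of_le_one_right' (hG1 _)
        _ = ∫⁻ y, F (y, p.1) := lintegral_sub_left_eq_self (fun y => F (y, p.1)) x
        _ = a p.1 := lintegral_indicator_eq_distrib hf p.1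
    · calc K p x ≤ ∫⁻ y, G (y, p.2) :=
            lintegral_mono fun y => mul_le_of_le_one_left' (hF1 _)
        _ = b p.2 := lintegral_indicator_eq_distrib hφ p.2
  have hK_int (p) : ∫⁻ x, K p x = a p.1 * b p.2 := by
    have hswap : ∫⁻ x, K p x = ∫⁻ y, ∫⁻ x, F (x - y, p.1) * G (y, p.2) :=
      lintegral_lintegral_swap (by fun_prop)
    have hx (y : EuclideanSpace ℝ (Fin n)) : ∫⁻ x, F (x - y, p.1) * G (y, p.2) = a p.1 * G (y, p.2) := by
      rw [lintegral_mul_const _ (by fun_prop),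
        lintegral_sub_right_eq_self (fun x => F (x, p.1)) y]
      congr 1
      exact lintegral_indicator_eq_distrib hf p.1
    simp_rw [hswap, hx]
    rw [lintegral_const_mul _ (by fun_prop)]
    congr 1
    exact lintegral_indicator_eq_distrib hφ p.2
  have hconv (x) : ‖conv f φ x‖ₑ ≤ ∫⁻ p, K p x ∂(ν.prod ν) := by
    refine (enorm_integral_le_lintegral_enorm _).trans_eq ?_
    have hy (y : EuclideanSpace ℝ (Fin n)) : ‖f (x - y) * φ y‖ₑ
        = ∫⁻ p, F (x - y, p.1) * G (y, p.2) ∂(ν.prod ν) := by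
      rw [enorm_mul, enorm_eq_lintegral_indicator f, enorm_eq_lintegral_indicator φ]
      exact (lintegral_prod_mul (f := fun s => F (x - y, s)) (g := fun s => G (y, s))
        (by fun_prop) (by fun_prop)).symm
    simp_rw [hy]
    exact lintegral_lintegral_swap (by fun_prop)
  let Q : Set (ℝ × ℝ) := {p | a p.1 < T ∧ b p.2 < T}
  have hQ : MeasurableSet Q :=
    (measurableSet_lt (ha.comp measurable_fst) measurable_const).inter
      (measurableSet_lt (hb.comp measurable_snd) measurable_const)
  have hH : Measurable fun x => ∫⁻ p in Q, K p x ∂(ν.prod ν) :=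
    Measurable.lintegral_prod_left hKm
  have hsplit (x) : ‖conv f φ x‖ₑ ≤ ∫⁻ p in Q, K p x ∂(ν.prod ν)
      + ∫⁻ p in Qᶜ, min (a p.1) (b p.2) ∂(ν.prod ν) := by
    refine (hconv x).trans ?_
    rw [← lintegral_add_compl _ hQ]
    gcongr with p
    exact hK_le p x
  calc _ ≤ _ := lintegral_rearr_le_of_le_add hH hsplit ht
    _ = ∫⁻ p in Q, a p.1 * b p.2 ∂(ν.prod ν)
        + ∫⁻ p in Qᶜ, T * min (a p.1) (b p.2) ∂(ν.prod ν) := by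
        rw [lintegral_const_mul _ (by fun_prop),
          lintegral_lintegral_swap (f := fun x p => K p x) (hKm.comp measurable_swap).aemeasurable]
        simp_rw [hK_int]
        rfl
    _ = ∫⁻ p, (if a p.1 < T ∧ b p.2 < T then a p.1 * b p.2 else T * min (a p.1) (b p.2))
          ∂(ν.prod ν) := by
        conv_rhs => rw [← lintegral_add_compl _ hQ]
        congr 1
        · exact setLIntegral_congr_fun hQ fun p hp => (if_pos hp).symm
        · exact setLIntegral_congr_fun hQ.compl fun p hp => (if_neg hp).symm
    _ ≤ ∫⁻ p, (min T (a p.1) * min T (b p.2) + T * (min (a p.1) (b p.2) - T)) ∂(ν.prod ν) :=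
        lintegral_mono fun p => oneil_weight_le _ _ _
    _ = _ := by
        rw [lintegral_add_left (by fun_prop), lintegral_const_mul _ (by fun_prop),
          lintegral_prod_mul (f := fun s => min T (a s)) (g := fun s => min T (b s))
            (by fun_prop) (by fun_prop),
          lintegral_rearr f ht, lintegral_rearr φ ht, lintegral_Ioi_rearr_mul_rearr f φ ht]

/-- **O'Neil's inequality**: for measurable `f, φ` on ℝⁿ and `t > 0`,
`(f∗φ)**(t) ≤ t f**(t) φ**(t) + ∫_t^∞ f*(s) φ*(s) ds`. -/
theorem oneil_inequality (n : ℕ)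
    (f φ : EuclideanSpace ℝ (Fin n) → ℝ) (hf : Measurable f) (hφ : Measurable φ)
    (t : ℝ) (ht : 0 < t) :
    maxFn volume (conv f φ) t ≤
      ENNReal.ofReal t * maxFn volume f t * maxFn volume φ t
        + ∫⁻ s in Set.Ioi t, rearr volume f s * rearr volume φ s := by
  have h0 : ENNReal.ofReal t ≠ 0 := by simpa using ht
  have htop : ENNReal.ofReal t ≠ ∞ := ENNReal.ofReal_ne_top
  unfold maxFn
  set T := ENNReal.ofReal t
  calc _ ≤ _ := mul_le_mul_right (lintegral_rearr_conv_le hf hφ ht) T⁻¹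
    _ = _ := by
      rw [mul_add, ← mul_assoc T⁻¹ T, ← mul_assoc T T⁻¹, ENNReal.inv_mul_cancel h0 htop,
        ENNReal.mul_inv_cancel h0 htop, one_mul, one_mul]
      ring
end
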